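/- Let 0 < α < 1. For the simple random walk on ℤ² there exist constants c₁, c₂ > 0 and N such that for all n ≥ N, c₁ · n / (ln(n))^{1−α} ≤ E[ Σ_{z ∈ ℤ²} (b_z^(n))^α ] ≤ c₂ · n / (ln(n))^{1−α}. -/

import Mathlib

/-!
The simple random walk on `ℤ²`.  A path of length `n` is a function `Fin n → Fin 4`
choosing at each time one of the four unit steps, each path having probability `4⁻ⁿ`.
-/

/-- The four unit steps of the simple random walk on `ℤ²`. -/
def stepVec : Fin 4 → ℤ × ℤ := ![(1, 0), (-1, 0), (0, 1), (0, -1)]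

/-- The position of the walk after `m` steps, along the path `ω`. -/
def pathPos {n : ℕ} (ω : Fin n → Fin 4) (m : ℕ) : ℤ × ℤ :=
  ∑ i ∈ Finset.univ.filter (fun i : Fin n => (i : ℕ) < m), stepVec (ω i)

/-- The local time `b_z⁽ⁿ⁾`: the number of visits to `z` up to time `n`. -/
def localTime {n : ℕ} (ω : Fin n → Fin 4) (z : ℤ × ℤ) : ℕ :=
  ((Finset.range (n + 1)).filter (fun m => pathPos ω m = z)).card

/-- Expectation of a functional of the simple random walk path of length `n`
(uniform measure on the `4 ^ n` paths). -/
noncomputable def expectSRW (n : ℕ) (g : (Fin n → Fin 4) → ℝ) : ℝ :=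
  (∑ ω : Fin n → Fin 4, g ω) / 4 ^ n


section Expectation

variable {n : ℕ}

theorem expectSRW_mono {f g : (Fin n → Fin 4) → ℝ} (h : ∀ ω, f ω ≤ g ω) :
    expectSRW n f ≤ expectSRW n g := by
  unfold expectSRW
  gcongr with ω
  exact h ω

theorem expectSRW_add (f g : (Fin n → Fin 4) → ℝ) :
    expectSRW n (fun ω => f ω + g ω) = expectSRW n f + expectSRW n g := by
  simp [expectSRW, Finset.sum_add_distrib, add_div]

theorem expectSRW_const_mul (c : ℝ) (f : (Fin n → Fin 4) → ℝ) :
    expectSRW n (fun ω => c * f ω) = c * expectSRW n f := by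
  simp [expectSRW, ← Finset.mul_sum, mul_div_assoc]

theorem expectSRW_const (c : ℝ) : expectSRW n (fun _ => c) = c := by
  simp [expectSRW]

theorem expectSRW_sum {ι : Type*} (s : Finset ι) (f : ι → (Fin n → Fin 4) → ℝ) :
    expectSRW n (fun ω => ∑ i ∈ s, f i ω) = ∑ i ∈ s, expectSRW n (f i) := by
  simp only [expectSRW]
  rw [Finset.sum_comm, Finset.sum_div]

/-- Functionals of disjoint sets of steps are uncorrelated. -/
theorem expectSRW_mul_of_dependsOn (s : Set (Fin n)) {f g : (Fin n → Fin 4) → ℝ}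
    (hf : DependsOn f s) (hg : DependsOn g sᶜ) :
    expectSRW n (fun ω => f ω * g ω) = expectSRW n f * expectSRW n g := by
  classical
  have key : ∑ p : (Fin n → Fin 4) × (Fin n → Fin 4), f p.1 * g p.2 =
      ∑ p : (Fin n → Fin 4) × (Fin n → Fin 4), f p.1 * g p.1 := by
    refine Finset.sum_nbij' (fun p => (s.piecewise p.1 p.2, s.piecewise p.2 p.1))
      (fun p => (s.piecewise p.1 p.2, s.piecewise p.2 p.1)) (by simp) (by simp) ?_ ?_ ?_
    · rintro ⟨a, b⟩ -
      ext i <;> by_cases hi : i ∈ s <;> simp [hi]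
    · rintro ⟨a, b⟩ -
      ext i <;> by_cases hi : i ∈ s <;> simp [hi]
    · rintro ⟨a, b⟩ -
      rw [hf (x := a) (y := s.piecewise a b) fun i hi => by simp [hi],
        hg (x := b) (y := s.piecewise a b) fun i hi => by
          simp [Set.piecewise_eq_of_notMem _ _ _ hi]]
  rw [Fintype.sum_prod_type, Fintype.sum_prod_type, ← Fintype.sum_mul_sum] at key
  simp only [Finset.sum_const, Finset.card_univ, Fintype.card_pi, Fintype.card_fin,
    Finset.prod_const, nsmul_eq_mul, ← Finset.mul_sum] at key
  unfold expectSRW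
  rw [div_mul_div_comm, key]
  push_cast
  field_simp

end Expectation

section ReturnProbability

/-- The probability that the walk is at the origin after `j` steps. -/
noncomputable def returnProb (j : ℕ) : ℝ :=
  if Even j then ((j / 2).centralBinom : ℝ) ^ 2 / 4 ^ j else 0

theorem Finset.card_filter_card_inter_eq {ι : Type*} [Fintype ι] [DecidableEq ι]
    (s : Finset ι) (k : ℕ) :
    (Finset.univ.filter fun A : Finset ι => (A ∩ s).card = k).card =
      s.card.choose k * 2 ^ (Fintype.card ι - s.card) := by
  rw [← Finset.card_compl, ← Finset.card_powersetCard, ← Finset.card_powerset,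
    ← Finset.card_product]
  refine Finset.card_nbij' (fun A => (A ∩ s, A \ s)) (fun p => p.1 ∪ p.2) ?_ ?_ ?_ ?_
  · intro A hA
    simp only [Finset.coe_filter, Finset.mem_univ, true_and, Set.mem_ofPred_eq] at hA
    simp [Finset.mem_powersetCard, hA, Finset.subset_iff]
  · rintro ⟨B, C⟩ h
    simp only [Finset.coe_product, Set.mem_prod, Finset.mem_coe, Finset.mem_powersetCard,
      Finset.mem_powerset] at h
    have : (B ∪ C) ∩ s = B := by
      ext i
      have h1 := @h.1.1 i
      have h2 := @h.2 i
      simp only [Finset.mem_compl] at h2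
      simp only [Finset.mem_inter, Finset.mem_union]
      tauto
    simp [this, h.1.2]
  · intro A _
    ext i
    simp only [Finset.mem_union, Finset.mem_inter, Finset.mem_sdiff]
    tauto
  · rintro ⟨B, C⟩ h
    simp only [Finset.coe_product, Set.mem_prod, Finset.mem_coe, Finset.mem_powersetCard,
      Finset.mem_powerset] at h
    ext i <;>
    · have h1 := @h.1.1 i
      have h2 := @h.2 i
      simp only [Finset.mem_compl] at h2
      simp only [Finset.mem_inter, Finset.mem_union, Finset.mem_sdiff]
      tauto

/-- The steps of the walk in the rotated coordinates `(x + y, x - y)` are pairs of signs. -/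
def stepEquivBool : Fin 4 ≃ Bool × Bool where
  toFun := ![(true, true), (false, false), (true, false), (false, true)]
  invFun p := bif p.1 then (bif p.2 then 0 else 2) else (bif p.2 then 3 else 1)
  left_inv := by decide
  right_inv := by decide

theorem stepVec_fst_add_snd (a : Fin 4) :
    (stepVec a).1 + (stepVec a).2 = 2 * (if (stepEquivBool a).1 then 1 else 0) - 1 := by
  revert a; decide

theorem stepVec_fst_sub_snd (a : Fin 4) :
    (stepVec a).1 - (stepVec a).2 = 2 * (if (stepEquivBool a).2 then 1 else 0) - 1 := by
  revert a; decide

theorem card_filter_sum_stepVec_eq_zero {n : ℕ} (s : Finset (Fin n)) :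
    (Finset.univ.filter fun ω : Fin n → Fin 4 => ∑ i ∈ s, stepVec (ω i) = 0).card =
      (Finset.univ.filter fun A : Finset (Fin n) => 2 * (A ∩ s).card = s.card).card ^ 2 := by
  rw [sq, ← Finset.card_product]
  refine Finset.card_nbij'
    (fun ω => (Finset.univ.filter fun i => (stepEquivBool (ω i)).1 = true,
      Finset.univ.filter fun i => (stepEquivBool (ω i)).2 = true))
    (fun p i => stepEquivBool.symm (decide (i ∈ p.1), decide (i ∈ p.2))) ?_ ?_ ?_ ?_
  · intro ω hω
    simp only [Finset.coe_filter, Finset.mem_univ, true_and, Set.mem_ofPred_eq, Prod.ext_iff,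
      Prod.fst_sum, Prod.snd_sum, Prod.fst_zero, Prod.snd_zero] at hω
    have h1 := Finset.sum_congr rfl fun i (_ : i ∈ s) => stepVec_fst_add_snd (ω i)
    have h2 := Finset.sum_congr rfl fun i (_ : i ∈ s) => stepVec_fst_sub_snd (ω i)
    rw [Finset.sum_add_distrib, Finset.sum_sub_distrib, ← Finset.mul_sum, Finset.sum_boole] at h1
    rw [Finset.sum_sub_distrib, Finset.sum_sub_distrib, ← Finset.mul_sum, Finset.sum_boole] at h2
    simp only [Finset.sum_const, nsmul_eq_mul, mul_one] at h1 h2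
    simp only [Finset.coe_product, Set.mem_prod, Finset.coe_filter, Finset.mem_univ, true_and,
      Set.mem_ofPred_eq, Finset.filter_inter, Finset.univ_inter]
    constructor <;> omega
  · rintro ⟨A, B⟩ h
    simp only [Finset.coe_product, Set.mem_prod, Finset.coe_filter, Finset.mem_univ, true_and,
      Set.mem_ofPred_eq] at h
    simp only [Finset.coe_filter, Finset.mem_univ, true_and, Set.mem_ofPred_eq, Prod.ext_iff,
      Prod.fst_sum, Prod.snd_sum, Prod.fst_zero, Prod.snd_zero]
    set ω : Fin n → Fin 4 := fun i => stepEquivBool.symm (decide (i ∈ A), decide (i ∈ B))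
    have h1 := Finset.sum_congr rfl fun i (_ : i ∈ s) => stepVec_fst_add_snd (ω i)
    have h2 := Finset.sum_congr rfl fun i (_ : i ∈ s) => stepVec_fst_sub_snd (ω i)
    rw [Finset.sum_add_distrib, Finset.sum_sub_distrib, ← Finset.mul_sum, Finset.sum_boole] at h1
    rw [Finset.sum_sub_distrib, Finset.sum_sub_distrib, ← Finset.mul_sum, Finset.sum_boole] at h2
    simp only [Finset.sum_const, nsmul_eq_mul, mul_one, ω, Equiv.apply_symm_apply,
      decide_eq_true_eq, Finset.filter_mem_eq_inter] at h1 h2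
    rw [Finset.inter_comm] at h1 h2
    have := h.1
    have := h.2
    constructor <;> omega
  · intro ω _
    funext i
    simp
  · rintro ⟨A, B⟩ _
    simp

theorem expectSRW_sum_stepVec_eq_zero {n : ℕ} (s : Finset (Fin n)) :
    expectSRW n (fun ω => if ∑ i ∈ s, stepVec (ω i) = 0 then 1 else 0) =
      returnProb s.card := by
  have hs : s.card ≤ n := by simpa using s.card_le_univ
  unfold expectSRW returnProb
  rw [Finset.sum_boole, card_filter_sum_stepVec_eq_zero]
  split_ifs with h
  · obtain ⟨k, hk⟩ := h
    have : (Finset.univ.filter fun A : Finset (Fin n) => 2 * (A ∩ s).card = s.card) =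
        Finset.univ.filter fun A : Finset (Fin n) => (A ∩ s).card = k := by
      ext A
      simp only [Finset.mem_filter, Finset.mem_univ, true_and]
      omega
    rw [this, Finset.card_filter_card_inter_eq, Fintype.card_fin]
    have hk2 : s.card / 2 = k := by omega
    rw [hk2, Nat.centralBinom, two_mul, ← hk]
    push_cast
    rw [mul_pow, ← pow_mul, mul_comm _ 2, pow_mul, div_eq_div_iff (by positivity) (by positivity)]
    have hpow : (4 : ℝ) ^ n = 4 ^ (n - s.card) * 4 ^ s.card := by
      rw [← pow_add, Nat.sub_add_cancel hs]
    rw [hpow]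
    norm_num
    ring
  · rw [Finset.filter_false_of_mem]
    · simp
    · intro A _ hA
      exact h ⟨_, by rw [← hA, two_mul]⟩

theorem centralBinom_sq_mul_le (k : ℕ) :
    (k.centralBinom : ℝ) ^ 2 * (2 * k + 1) ≤ 4 ^ (2 * k) := by
  induction k with
  | zero => simp
  | succ k ih =>
    have h : ((k : ℝ) + 1) * (k + 1).centralBinom = 2 * (2 * k + 1) * k.centralBinom := by
      exact_mod_cast Nat.succ_mul_centralBinom_succ k
    have h2 : ((k : ℝ) + 1) ^ 2 * ((k + 1).centralBinom : ℝ) ^ 2 =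
        4 * (2 * k + 1) ^ 2 * (k.centralBinom : ℝ) ^ 2 := by
      rw [← mul_pow, h]; ring
    have hpow : (4 : ℝ) ^ (2 * (k + 1)) = 16 * 4 ^ (2 * k) := by
      rw [mul_add, pow_add]; norm_num; ring
    rw [hpow]
    have hk : (0 : ℝ) ≤ k := k.cast_nonneg
    refine le_of_mul_le_mul_left ?_ (by positivity : (0 : ℝ) < ((k : ℝ) + 1) ^ 2)
    push_cast
    calc ((k : ℝ) + 1) ^ 2 * (((k + 1).centralBinom : ℝ) ^ 2 * (2 * (k + 1) + 1))
        = (k.centralBinom : ℝ) ^ 2 * (2 * k + 1) * (4 * ((2 * k + 1) * (2 * k + 3))) := by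
          rw [← mul_assoc ((_ : ℝ) ^ 2), h2]; ring
      _ ≤ (4 : ℝ) ^ (2 * k) * (4 * (2 * k + 2) ^ 2) := by
          gcongr
          nlinarith
      _ = _ := by ring

theorem pow_le_centralBinom_sq_mul (k : ℕ) :
    (4 : ℝ) ^ (2 * k) ≤ (k.centralBinom : ℝ) ^ 2 * (4 * k + 1) := by
  induction k with
  | zero => simp
  | succ k ih =>
    have h : ((k : ℝ) + 1) * (k + 1).centralBinom = 2 * (2 * k + 1) * k.centralBinom := by
      exact_mod_cast Nat.succ_mul_centralBinom_succ k
    have h2 : ((k : ℝ) + 1) ^ 2 * ((k + 1).centralBinom : ℝ) ^ 2 =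
        4 * (2 * k + 1) ^ 2 * (k.centralBinom : ℝ) ^ 2 := by
      rw [← mul_pow, h]; ring
    have hpow : (4 : ℝ) ^ (2 * (k + 1)) = 16 * 4 ^ (2 * k) := by
      rw [mul_add, pow_add]; norm_num; ring
    rw [hpow]
    have hk : (0 : ℝ) ≤ k := k.cast_nonneg
    refine le_of_mul_le_mul_left ?_ (by positivity : (0 : ℝ) < ((k : ℝ) + 1) ^ 2)
    push_cast
    calc ((k : ℝ) + 1) ^ 2 * (16 * 4 ^ (2 * k))
        ≤ ((k : ℝ) + 1) ^ 2 * (16 * ((k.centralBinom : ℝ) ^ 2 * (4 * k + 1))) := by gcongr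
      _ = (k.centralBinom : ℝ) ^ 2 * (4 * (4 * (k + 1) ^ 2 * (4 * k + 1))) := by ring
      _ ≤ (k.centralBinom : ℝ) ^ 2 * (4 * ((2 * k + 1) ^ 2 * (4 * k + 5))) := by
          refine mul_le_mul_of_nonneg_left ?_ (by positivity)
          nlinarith
      _ = _ := by linear_combination -(4 * (k : ℝ) + 5) * h2

theorem returnProb_nonneg (j : ℕ) : 0 ≤ returnProb j := by
  unfold returnProb
  split_ifs <;> positivity

theorem returnProb_le (j : ℕ) : returnProb j ≤ 1 / ((j : ℝ) + 1) := by
  unfold returnProb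
  split_ifs with h
  · obtain ⟨k, rfl⟩ := h
    have := centralBinom_sq_mul_le k
    rw [← two_mul, Nat.mul_div_cancel_left _ two_pos, div_le_div_iff₀ (by positivity)
      (by positivity)]
    push_cast
    linarith
  · positivity

theorem le_returnProb_two_mul (k : ℕ) : 1 / (4 * ((k : ℝ) + 1)) ≤ returnProb (2 * k) := by
  have := pow_le_centralBinom_sq_mul k
  rw [returnProb, if_pos (even_two_mul k), Nat.mul_div_cancel_left _ two_pos,
    div_le_div_iff₀ (by positivity) (by positivity)]
  nlinarith [sq_nonneg (k.centralBinom : ℝ)]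

theorem sum_returnProb_le (n : ℕ) :
    ∑ j ∈ Finset.range (n + 1), returnProb j ≤ 1 + Real.log (n + 1) := by
  have h := harmonic_le_one_add_log (n + 1)
  simp only [harmonic, Rat.cast_sum] at h
  push_cast at h
  refine (Finset.sum_le_sum fun j _ => ?_).trans h
  simpa using returnProb_le j

theorem log_le_sum_returnProb (n : ℕ) :
    Real.log (n + 1) / 8 ≤ ∑ j ∈ Finset.range (n + 1), returnProb j := by
  have h := log_add_one_le_harmonic (n / 2 + 1)
  simp only [harmonic, Rat.cast_sum] at h
  push_cast at h
  have h1 : ∑ k ∈ Finset.range (n / 2 + 1), ((k : ℝ) + 1)⁻¹ / 4 ≤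
      ∑ j ∈ Finset.range (n + 1), returnProb j := by
    calc ∑ k ∈ Finset.range (n / 2 + 1), ((k : ℝ) + 1)⁻¹ / 4
        ≤ ∑ k ∈ Finset.range (n / 2 + 1), returnProb (2 * k) := by
          refine Finset.sum_le_sum fun k _ => le_trans (le_of_eq ?_) (le_returnProb_two_mul k)
          rw [one_div, mul_inv]; ring
      _ = ∑ j ∈ (Finset.range (n / 2 + 1)).image (2 * ·), returnProb j := by
          rw [Finset.sum_image (by intro a _ b _ hab; simpa using hab)]
      _ ≤ _ := by
          refine Finset.sum_le_sum_of_subset_of_nonneg ?_ fun j _ _ => returnProb_nonneg j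
          intro j hj
          simp only [Finset.mem_image, Finset.mem_range] at hj ⊢
          omega
  rw [← Finset.sum_div] at h1
  have h2 : Real.log (n + 1) ≤ 2 * Real.log (((n / 2 : ℕ) : ℝ) + 1 + 1) := by
    rw [← Real.log_rpow (by positivity), Real.rpow_two]
    refine Real.log_le_log (by positivity) ?_
    have : (n : ℝ) ≤ 2 * ((n / 2 : ℕ) : ℝ) + 1 := by
      exact_mod_cast (by omega : n ≤ 2 * (n / 2) + 1)
    nlinarith [sq_nonneg (((n / 2 : ℕ) : ℝ))]
  linarith

end ReturnProbability

section Walk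

variable {n : ℕ}

theorem pathPos_add (ω : Fin n → Fin 4) (m j : ℕ) :
    pathPos ω (m + j) = pathPos ω m +
      ∑ i ∈ Finset.univ.filter (fun i : Fin n => m ≤ (i : ℕ) ∧ (i : ℕ) < m + j),
        stepVec (ω i) := by
  unfold pathPos
  rw [← Finset.sum_union]
  · congr 1
    ext i
    simp only [Finset.mem_filter, Finset.mem_univ, true_and, Finset.mem_union]
    omega
  · rw [Finset.disjoint_left]
    intro i
    simp only [Finset.mem_filter, Finset.mem_univ, true_and]
    omega

theorem card_filter_le_and_lt_add {m j : ℕ} (h : m + j ≤ n) :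
    (Finset.univ.filter (fun i : Fin n => m ≤ (i : ℕ) ∧ (i : ℕ) < m + j)).card = j := by
  rw [← Finset.card_map Fin.valEmbedding]
  have : (Finset.univ.filter (fun i : Fin n => m ≤ (i : ℕ) ∧ (i : ℕ) < m + j)).map
      Fin.valEmbedding = Finset.Ico m (m + j) := by
    ext a
    simp only [Finset.mem_map, Finset.mem_filter, Finset.mem_univ, true_and,
      Fin.valEmbedding_apply, Finset.mem_Ico]
    constructor
    · rintro ⟨i, hi, rfl⟩
      exact hi
    · intro ha
      exact ⟨⟨a, by omega⟩, ha, rfl⟩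
  rw [this]
  simp

/-- An event determined by the first `m` steps is independent of the walk returning, `j` steps
later, to its position at time `m`. -/
theorem expectSRW_mul_return {m j : ℕ} (h : m + j ≤ n) {f : (Fin n → Fin 4) → ℝ}
    (hf : DependsOn f {i : Fin n | (i : ℕ) < m}) :
    expectSRW n (fun ω => f ω * if pathPos ω (m + j) = pathPos ω m then 1 else 0) =
      expectSRW n f * returnProb j := by
  simp only [pathPos_add, add_eq_left]
  rw [expectSRW_mul_of_dependsOn _ hf, expectSRW_sum_stepVec_eq_zero,
    card_filter_le_and_lt_add h]
  intro ω ω' hω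
  have : ∑ i ∈ Finset.univ.filter (fun i : Fin n => m ≤ (i : ℕ) ∧ (i : ℕ) < m + j),
        stepVec (ω i) =
      ∑ i ∈ Finset.univ.filter (fun i : Fin n => m ≤ (i : ℕ) ∧ (i : ℕ) < m + j),
        stepVec (ω' i) := by
    refine Finset.sum_congr rfl fun i hi => ?_
    rw [hω i]
    simp only [Finset.mem_filter, Finset.mem_univ, true_and] at hi
    simpa using hi.1
  simp only [this]

theorem expectSRW_pathPos_eq {m j : ℕ} (h : m + j ≤ n) :
    expectSRW n (fun ω => if pathPos ω (m + j) = pathPos ω m then 1 else 0) =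
      returnProb j := by
  have := expectSRW_mul_return h (f := fun _ => 1) (fun _ _ _ => rfl)
  simpa [expectSRW_const] using this

/-- The set of sites visited up to time `n`. -/
def visited (ω : Fin n → Fin 4) : Finset (ℤ × ℤ) :=
  (Finset.range (n + 1)).image (pathPos ω)

theorem sum_comp_pathPos (ω : Fin n → Fin 4) (f : ℤ × ℤ → ℝ) :
    ∑ m ∈ Finset.range (n + 1), f (pathPos ω m) =
      ∑ z ∈ visited ω, (localTime ω z : ℝ) * f z := by
  rw [Finset.sum_comp f (pathPos ω)]
  simp only [nsmul_eq_mul]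
  rfl

theorem sum_localTime (ω : Fin n → Fin 4) :
    ∑ z ∈ visited ω, (localTime ω z : ℝ) = n + 1 := by
  have := sum_comp_pathPos ω fun _ => 1
  simpa using this.symm

theorem sum_localTime_sq (ω : Fin n → Fin 4) :
    ∑ z ∈ visited ω, (localTime ω z : ℝ) ^ 2 =
      ∑ m ∈ Finset.range (n + 1), ∑ k ∈ Finset.range (n + 1),
        if pathPos ω k = pathPos ω m then 1 else 0 := by
  simp only [sq]
  rw [← sum_comp_pathPos ω fun z => (localTime ω z : ℝ)]
  simp [localTime]

theorem localTime_eq_zero {ω : Fin n → Fin 4} {z : ℤ × ℤ} (hz : z ∉ visited ω) :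
    localTime ω z = 0 := by
  simp only [visited, Finset.mem_image, not_exists, not_and] at hz
  rw [localTime, Finset.card_eq_zero, Finset.filter_eq_empty_iff]
  exact fun {m} => hz m

theorem localTime_pos {ω : Fin n → Fin 4} {z : ℤ × ℤ} (hz : z ∈ visited ω) :
    0 < localTime ω z := by
  obtain ⟨m, hm, rfl⟩ := Finset.mem_image.1 hz
  exact Finset.card_pos.2 ⟨m, Finset.mem_filter.2 ⟨hm, rfl⟩⟩

theorem tsum_localTime_rpow (ω : Fin n → Fin 4) {α : ℝ} (hα : 0 < α) :
    ∑' z : ℤ × ℤ, (localTime ω z : ℝ) ^ α =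
      ∑ z ∈ visited ω, (localTime ω z : ℝ) ^ α :=
  tsum_eq_sum fun z hz => by simp [localTime_eq_zero hz, Real.zero_rpow hα.ne']

theorem expectSRW_sum_localTime_sq_le (n : ℕ) :
    expectSRW n (fun ω => ∑ z ∈ visited ω, (localTime ω z : ℝ) ^ 2) ≤
      (n + 1) * (2 * (1 + Real.log (n + 1))) := by
  simp only [sum_localTime_sq]
  rw [expectSRW_sum]
  have key : ∀ m ∈ Finset.range (n + 1),
      expectSRW n (fun ω => ∑ k ∈ Finset.range (n + 1),
        if pathPos ω k = pathPos ω m then 1 else 0) ≤ 2 * (1 + Real.log (n + 1)) := by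
    intro m hm
    rw [Finset.mem_range] at hm
    rw [expectSRW_sum, ← Finset.sum_filter_add_sum_filter_not _ (fun k => k ≤ m), two_mul]
    refine add_le_add ?_ ?_
    · refine le_trans ?_ (sum_returnProb_le n)
      calc _ = ∑ k ∈ (Finset.range (n + 1)).filter (fun k => k ≤ m), returnProb (m - k) := by
            refine Finset.sum_congr rfl fun k hk => ?_
            have hk' := (Finset.mem_filter.1 hk).2
            rw [← expectSRW_pathPos_eq (n := n) (m := k) (by omega), Nat.add_sub_cancel' hk']
            simp only [eq_comm]
        _ = ∑ j ∈ ((Finset.range (n + 1)).filter (fun k => k ≤ m)).image (fun k => m - k),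
              returnProb j := by
            rw [Finset.sum_image]
            intro a ha b hb hab
            simp only [Finset.coe_filter, Set.mem_ofPred_eq] at ha hb
            dsimp only at hab
            omega
        _ ≤ _ := by
            refine Finset.sum_le_sum_of_subset_of_nonneg ?_ fun j _ _ => returnProb_nonneg j
            intro j hj
            simp only [Finset.mem_image, Finset.mem_range] at hj ⊢
            omega
    · refine le_trans ?_ (sum_returnProb_le n)
      calc _ = ∑ k ∈ (Finset.range (n + 1)).filter (fun k => ¬ k ≤ m), returnProb (k - m) := by
            refine Finset.sum_congr rfl fun k hk => ?_
            simp only [Finset.mem_filter, Finset.mem_range] at hk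
            rw [← expectSRW_pathPos_eq (n := n) (m := m) (by omega),
              Nat.add_sub_cancel' (by omega)]
        _ = ∑ j ∈ ((Finset.range (n + 1)).filter (fun k => ¬ k ≤ m)).image (fun k => k - m),
              returnProb j := by
            rw [Finset.sum_image]
            intro a ha b hb hab
            simp only [Finset.coe_filter, Set.mem_ofPred_eq] at ha hb
            dsimp only at hab
            omega
        _ ≤ _ := by
            refine Finset.sum_le_sum_of_subset_of_nonneg ?_ fun j _ _ => returnProb_nonneg j
            intro j hj
            simp only [Finset.mem_image, Finset.mem_filter, Finset.mem_range] at hj ⊢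
            omega
  refine (Finset.sum_le_card_nsmul _ _ _ key).trans (le_of_eq ?_)
  simp

/-- The walk visits a new site at time `m`. -/
def IsFirstVisit (ω : Fin n → Fin 4) (m : ℕ) : Prop :=
  ∀ k < m, pathPos ω k ≠ pathPos ω m

open Classical in
theorem card_visited_le (ω : Fin n → Fin 4) :
    (visited ω).card ≤ ((Finset.range (n + 1)).filter (IsFirstVisit ω)).card := by
  refine le_trans (Finset.card_le_card ?_) (Finset.card_image_le (f := pathPos ω))
  intro z hz
  have hex : ∃ m, pathPos ω m = z := by
    obtain ⟨m, -, hm⟩ := Finset.mem_image.1 hz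
    exact ⟨m, hm⟩
  obtain ⟨m, hm, hmz⟩ := Finset.mem_image.1 hz
  rw [Finset.mem_range] at hm
  have hle := Nat.find_min' hex hmz
  refine Finset.mem_image.2 ⟨Nat.find hex, Finset.mem_filter.2 ⟨?_, ?_⟩, Nat.find_spec hex⟩
  · rw [Finset.mem_range]
    omega
  · intro k hk
    rw [Nat.find_spec hex]
    exact Nat.find_min hex hk

open Classical in
theorem sum_firstVisit_mul_return_le (ω : Fin n → Fin 4) {M L : ℕ} (h : M + L ≤ n) :
    ∑ m ∈ Finset.range (M + 1), ∑ j ∈ Finset.range (L + 1),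
      (if IsFirstVisit ω m then (1 : ℝ) else 0) *
        (if pathPos ω (m + j) = pathPos ω m then 1 else 0) ≤ n + 1 := by
  rw [← Finset.sum_product']
  simp only [← ite_and, ite_mul, one_mul, zero_mul]
  rw [Finset.sum_boole]
  have : (((Finset.range (M + 1)) ×ˢ (Finset.range (L + 1))).filter
      fun p : ℕ × ℕ => IsFirstVisit ω p.1 ∧ pathPos ω (p.1 + p.2) = pathPos ω p.1).card ≤
      (Finset.range (n + 1)).card := by
    refine Finset.card_le_card_of_injOn (fun p => p.1 + p.2) ?_ ?_
    · intro p hp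
      simp only [Finset.coe_filter, Finset.mem_product, Finset.mem_range, Set.mem_ofPred_eq]
        at hp
      simp only [Finset.coe_range, Set.mem_Iio]
      omega
    · rintro ⟨a, b⟩ hp ⟨c, d⟩ hq heq
      simp only [Finset.coe_filter, Finset.mem_product, Finset.mem_range, Set.mem_ofPred_eq]
        at hp hq heq
      have hac : pathPos ω a = pathPos ω c := by
        rw [← hp.2.2, ← hq.2.2, heq]
      have h1 : ¬ a < c := fun hlt => hq.2.1 a hlt hac
      have h2 : ¬ c < a := fun hlt => hp.2.1 c hlt hac.symm
      ext <;> dsimp only <;> omega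
  rw [Finset.card_range] at this
  exact_mod_cast this

open Classical in
theorem dependsOn_isFirstVisit (m : ℕ) :
    DependsOn (fun ω : Fin n → Fin 4 => if IsFirstVisit ω m then (1 : ℝ) else 0)
      {i : Fin n | (i : ℕ) < m} := by
  intro ω ω' h
  have hpos : ∀ k ≤ m, pathPos ω k = pathPos ω' k := by
    intro k hk
    refine Finset.sum_congr rfl fun i hi => ?_
    rw [h i]
    exact (Finset.mem_filter.1 hi).2.trans_le hk
  have : IsFirstVisit ω m ↔ IsFirstVisit ω' m := by
    unfold IsFirstVisit
    refine forall₂_congr fun k hk => ?_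
    rw [hpos k hk.le, hpos m le_rfl]
  simp only [this]

theorem expectSRW_card_visited_mul_le {M L : ℕ} (h : M + L = n) :
    (expectSRW n (fun ω => ((visited ω).card : ℝ)) - L) *
      ∑ j ∈ Finset.range (L + 1), returnProb j ≤ n + 1 := by
  classical
  set F : ℕ → (Fin n → Fin 4) → ℝ := fun m ω => if IsFirstVisit ω m then 1 else 0
  have h1 : expectSRW n (fun ω => ((visited ω).card : ℝ)) ≤
      (∑ m ∈ Finset.range (M + 1), expectSRW n (F m)) + L := by
    rw [← expectSRW_sum, ← expectSRW_const (n := n) (L : ℝ), ← expectSRW_add]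
    refine expectSRW_mono fun ω => ?_
    calc ((visited ω).card : ℝ)
        ≤ (((Finset.range (n + 1)).filter (IsFirstVisit ω)).card : ℝ) := by
          exact_mod_cast card_visited_le ω
      _ = ∑ m ∈ Finset.range (M + 1 + L), F m ω := by
          rw [← Finset.sum_boole, show n + 1 = M + 1 + L by omega]
      _ = ∑ m ∈ Finset.range (M + 1), F m ω + ∑ m ∈ Finset.range L, F (M + 1 + m) ω :=
          Finset.sum_range_add _ _ _
      _ ≤ _ := by
          refine add_le_add le_rfl ?_
          refine (Finset.sum_le_card_nsmul _ _ 1 fun m _ => ?_).trans (by simp)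
          dsimp only [F]
          split_ifs <;> norm_num
  have h2 : (∑ m ∈ Finset.range (M + 1), expectSRW n (F m)) *
      ∑ j ∈ Finset.range (L + 1), returnProb j ≤ n + 1 := by
    rw [Finset.sum_mul_sum, ← expectSRW_const (n := n) ((n : ℝ) + 1)]
    refine le_trans (le_of_eq ?_)
      (expectSRW_mono fun ω => sum_firstVisit_mul_return_le ω h.le)
    rw [expectSRW_sum]
    refine Finset.sum_congr rfl fun m hm => ?_
    rw [expectSRW_sum]
    refine Finset.sum_congr rfl fun j hj => ?_
    rw [Finset.mem_range] at hm hj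
    rw [expectSRW_mul_return (by omega) (dependsOn_isFirstVisit m)]
  refine le_trans (mul_le_mul_of_nonneg_right ?_
    (Finset.sum_nonneg fun j _ => returnProb_nonneg j)) h2
  linarith

theorem expectSRW_card_visited_le (hn : 2 ≤ n) :
    expectSRW n (fun ω => ((visited ω).card : ℝ)) ≤ 34 * n / Real.log n := by
  have hn' : (2 : ℝ) ≤ n := by exact_mod_cast hn
  have hlog : 0 < Real.log n := Real.log_pos (by linarith)
  have h := expectSRW_card_visited_mul_le (Nat.sub_add_cancel (Nat.sqrt_le_self n))
  have hsqrt : Real.sqrt n ≤ Nat.sqrt n + 1 := Real.real_sqrt_le_nat_sqrt_succ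
  have hG := log_le_sum_returnProb (Nat.sqrt n)
  have hlogs : Real.log n / 2 ≤ Real.log (Nat.sqrt n + 1) := by
    rw [← Real.log_sqrt (by linarith)]
    exact Real.log_le_log (Real.sqrt_pos.2 (by linarith)) hsqrt
  have hL : (Nat.sqrt n : ℝ) ≤ 2 * n / Real.log n := by
    have hs : (Nat.sqrt n : ℝ) ≤ Real.sqrt n := Real.nat_sqrt_le_real_sqrt
    have hl : Real.log n ≤ 2 * Real.sqrt n := by
      have := Real.log_le_sub_one_of_pos (Real.sqrt_pos.2 (by linarith : (0 : ℝ) < n))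
      rw [Real.log_sqrt (by linarith)] at this
      linarith
    rw [le_div_iff₀ hlog]
    nlinarith [Real.mul_self_sqrt (by linarith : (0 : ℝ) ≤ n), Real.sqrt_nonneg (n : ℝ)]
  have hR : expectSRW n (fun ω => ((visited ω).card : ℝ)) - Nat.sqrt n ≤
      32 * n / Real.log n := by
    rw [le_div_iff₀ hlog]
    by_cases hpos : 0 ≤ expectSRW n (fun ω => ((visited ω).card : ℝ)) - Nat.sqrt n
    · nlinarith
    · nlinarith
  calc expectSRW n (fun ω => ((visited ω).card : ℝ))
      ≤ 32 * n / Real.log n + 2 * n / Real.log n := by linarith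
    _ = _ := by ring

end Walk

section PowerBounds

theorem rpow_le_rpow_sub_one_mul_add {α x t : ℝ} (hα0 : 0 < α) (hα1 : α < 1) (hx : 0 < x)
    (ht : 0 < t) : x ^ α ≤ t ^ (α - 1) * (x + t) := by
  rcases le_total x t with h | h
  · calc x ^ α ≤ t ^ α := Real.rpow_le_rpow hx.le h hα0.le
      _ = t ^ (α - 1) * t := by rw [Real.rpow_sub_one ht.ne']; field_simp
      _ ≤ _ := by gcongr; linarith
  · calc x ^ α = x ^ (α - 1) * x := by rw [Real.rpow_sub_one hx.ne']; field_simp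
      _ ≤ t ^ (α - 1) * x := by
          gcongr ?_ * x
          exact Real.rpow_le_rpow_of_nonpos ht h (by linarith)
      _ ≤ _ := by gcongr; linarith

theorem rpow_sub_one_mul_sub_le_rpow {α x t : ℝ} (hα1 : α < 1) (hx : 0 < x) (ht : 0 < t) :
    t ^ (α - 1) * (x - x ^ 2 / t) ≤ x ^ α := by
  have hxα : x ^ α = x ^ (α - 1) * x := by rw [Real.rpow_sub_one hx.ne']; field_simp
  rcases le_total x t with h | h
  · calc t ^ (α - 1) * (x - x ^ 2 / t) ≤ t ^ (α - 1) * x := by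
          gcongr
          linarith [div_nonneg (sq_nonneg x) ht.le]
      _ ≤ x ^ (α - 1) * x := by
          gcongr ?_ * x
          exact Real.rpow_le_rpow_of_nonpos hx h (by linarith)
      _ = _ := hxα.symm
  · refine le_trans (mul_nonpos_of_nonneg_of_nonpos (by positivity) ?_) (by positivity)
    rw [sub_nonpos, le_div_iff₀ ht]
    nlinarith

end PowerBounds

/-- Let `0 < α < 1`.  For the simple random walk on `ℤ²` there
exist constants `c₁, c₂ > 0` and `N` such that for all `n ≥ N`,
`c₁ · n / (ln n)^(1-α) ≤ E[Σ_{z ∈ ℤ²} (b_z⁽ⁿ⁾)^α] ≤ c₂ · n / (ln n)^(1-α)`. -/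
theorem expected_local_time_rpow (α : ℝ) (hα0 : 0 < α) (hα1 : α < 1) :
    ∃ c₁ > (0 : ℝ), ∃ c₂ > (0 : ℝ), ∃ N : ℕ, ∀ n : ℕ, N ≤ n →
      c₁ * ((n : ℝ) / Real.log n ^ (1 - α))
          ≤ expectSRW n (fun ω => ∑' z : ℤ × ℤ, (localTime ω z : ℝ) ^ α) ∧
      expectSRW n (fun ω => ∑' z : ℤ × ℤ, (localTime ω z : ℝ) ^ α)
          ≤ c₂ * ((n : ℝ) / Real.log n ^ (1 - α)) := by
  refine ⟨12 ^ (α - 1) / 2, by positivity, 36, by norm_num, 3, fun n hn => ?_⟩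
  have hn' : (3 : ℝ) ≤ n := by exact_mod_cast hn
  have hlog : 1 ≤ Real.log n := by
    rw [Real.le_log_iff_exp_le (by linarith)]
    linarith [Real.exp_one_lt_d9]
  have hlog0 : 0 < Real.log n := by linarith
  have hpow : (n : ℝ) / Real.log n ^ (1 - α) = Real.log n ^ (α - 1) * n := by
    rw [← neg_sub α 1, Real.rpow_neg hlog0.le, div_inv_eq_mul, mul_comm]
  simp only [tsum_localTime_rpow _ hα0, hpow]
  constructor
  · set t := 12 * Real.log n with ht
    have ht0 : 0 < t := by positivity
    have hI := expectSRW_sum_localTime_sq_le n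
    have hlog1 : Real.log (n + 1) ≤ 2 * Real.log n := by
      rw [← Real.log_rpow (by linarith), Real.rpow_two]
      exact Real.log_le_log (by linarith) (by nlinarith)
    calc 12 ^ (α - 1) / 2 * (Real.log n ^ (α - 1) * n)
        = t ^ (α - 1) * (n / 2) := by
          rw [ht, Real.mul_rpow (by norm_num) hlog0.le]; ring
      _ ≤ t ^ (α - 1) * ((n + 1) + (-1 / t) *
            expectSRW n (fun ω => ∑ z ∈ visited ω, (localTime ω z : ℝ) ^ 2)) := by
          gcongr
          have : 1 / t * expectSRW n (fun ω => ∑ z ∈ visited ω, (localTime ω z : ℝ) ^ 2) ≤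
              (n + 1) / 2 := by
            rw [one_div_mul_eq_div, div_le_iff₀ ht0]
            refine hI.trans ?_
            rw [ht]
            nlinarith
          rw [neg_div, neg_mul]
          linarith
      _ = expectSRW n (fun ω => t ^ (α - 1) * ((n + 1) + (-1 / t) *
            ∑ z ∈ visited ω, (localTime ω z : ℝ) ^ 2)) := by
          rw [expectSRW_const_mul, expectSRW_add, expectSRW_const, expectSRW_const_mul]
      _ ≤ _ := by
          refine expectSRW_mono fun ω => ?_
          rw [← sum_localTime ω, Finset.mul_sum, ← Finset.sum_add_distrib, Finset.mul_sum]
          refine Finset.sum_le_sum fun z hz => ?_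
          have hz' : (0 : ℝ) < localTime ω z := by exact_mod_cast localTime_pos hz
          refine le_trans (le_of_eq ?_) (rpow_sub_one_mul_sub_le_rpow hα1 hz' ht0)
          ring
  · calc expectSRW n (fun ω => ∑ z ∈ visited ω, (localTime ω z : ℝ) ^ α)
        ≤ expectSRW n (fun ω => Real.log n ^ (α - 1) *
            ((n + 1) + Real.log n * (visited ω).card)) := by
          refine expectSRW_mono fun ω => ?_
          have hcard : Real.log n * (visited ω).card = ∑ z ∈ visited ω, Real.log n := by
            rw [Finset.sum_const, nsmul_eq_mul, mul_comm]
          rw [← sum_localTime ω, hcard, ← Finset.sum_add_distrib, Finset.mul_sum]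
          refine Finset.sum_le_sum fun z hz => ?_
          have hz' : (0 : ℝ) < localTime ω z := by exact_mod_cast localTime_pos hz
          exact rpow_le_rpow_sub_one_mul_add hα0 hα1 hz' hlog0
      _ = Real.log n ^ (α - 1) * ((n + 1) + Real.log n *
            expectSRW n (fun ω => ((visited ω).card : ℝ))) := by
          rw [expectSRW_const_mul, expectSRW_add, expectSRW_const, expectSRW_const_mul]
      _ ≤ Real.log n ^ (α - 1) * (36 * n) := by
          gcongr
          have hR := expectSRW_card_visited_le (n := n) (by omega)
          rw [le_div_iff₀ hlog0] at hR
          linarith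
      _ = _ := by ring
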